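/- Let M be a complex vector space equipped with a rank-r Weyl system t_1,…,t_r, ∂_1,…,∂_r and an abstract V-filtration (V^χ)_{χ∈ℚ} that is exhaustive (⋃_χ V^χ = M) and discrete (there is a positive integer e such that for each k ∈ ℤ the subspace V^χ is constant for χ ∈ (k/e, (k+1)/e]). Let (F_p)_{p∈ℤ} be an increasing exhaustive family of subspaces of M with t_i(F_p) ⊆ F_p and ∂_i(F_p) ⊆ F_{p+1} for all i, p. Write gr^β := V^β/V^{>β} and F_q gr^β := ((F_q ∩ V^β) + V^{>β})/V^{>β}. Assume that for every rational χ < 0 and every p ∈ ℤ the complex whose ℓ-th term (ℓ = 0,…,r) is (F_{p+ℓ} gr^{χ+r−ℓ}) ⊗ Λ^ℓ(ℂ^r) and whose differential is induced by m⊗ω ↦ Σ_{i=1}^r ∂_i(m)⊗(e_i∧ω) is exact. Then for every p ∈ ℤ: F_p = Σ_{α∈ℕ^r} ∂^α(F_{p−|α|} ∩ V^0), where ∂^α := ∂_1^{α_1}∘…∘∂_r^{α_r} and |α| = α_1+…+α_r. -/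

import Mathlib

open TensorProduct

noncomputable section

/-- Wedging on the left with a fixed vector `v`, as a linear map `⋀^ℓ M → ⋀^(ℓ+1) M`,
`ω ↦ v ∧ ω`. -/
def wedgeMap (R : Type*) [CommRing R] {M : Type*} [AddCommGroup M] [Module R M]
    (v : M) (ℓ : ℕ) : ⋀[R]^ℓ M →ₗ[R] ⋀[R]^(ℓ+1) M :=
  LinearMap.codRestrict _
    ((LinearMap.mulLeft R (ExteriorAlgebra.ι R v)).comp (Submodule.subtype _))
    (fun ω => by
      have h : ExteriorAlgebra.ι R v * (ω : ExteriorAlgebra R M) ∈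
          (LinearMap.range (ExteriorAlgebra.ι R : M →ₗ[R] ExteriorAlgebra R M)) ^ (ℓ + 1) := by
        rw [pow_succ']
        exact Submodule.mul_mem_mul (LinearMap.mem_range_self _ v) ω.2
      simpa using h)

/-- `V^{>χ} := ⋃_{β > χ} V^β` (a union of a directed family of subspaces, hence the sup). -/
def Vgt {M : Type*} [AddCommGroup M] [Module ℂ M] (V : ℚ → Submodule ℂ M) (χ : ℚ) :
    Submodule ℂ M :=
  ⨆ β > χ, V β

/-- The graded piece `gr^β(M) := V^β / V^{>β}`. -/
abbrev Gr {M : Type*} [AddCommGroup M] [Module ℂ M] (V : ℚ → Submodule ℂ M) (β : ℚ) :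
    Type _ :=
  (V β) ⧸ ((Vgt V β).comap (V β).subtype)

/-- `F_q gr^β := ((F_q ∩ V^β) + V^{>β}) / V^{>β}`, i.e. the image of `F_q ∩ V^β` in
`gr^β(M)`. -/
def FGr {M : Type*} [AddCommGroup M] [Module ℂ M] (V : ℚ → Submodule ℂ M)
    (Fq : Submodule ℂ M) (β : ℚ) : Submodule ℂ (Gr V β) :=
  Submodule.map ((Vgt V β).comap (V β).subtype).mkQ (Fq.comap (V β).subtype)

/-- The map `F_q gr^β → F_q' gr^β'` induced by an endomorphism `f` compatible with both
filtrations. -/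
def FGrMap {M : Type*} [AddCommGroup M] [Module ℂ M] (V : ℚ → Submodule ℂ M)
    {G G' : Submodule ℂ M} {β β' : ℚ} (f : Module.End ℂ M)
    (hV : ∀ m ∈ V β, f m ∈ V β') (hgt : ∀ m ∈ Vgt V β, f m ∈ Vgt V β')
    (hG : ∀ m ∈ G, f m ∈ G') : FGr V G β →ₗ[ℂ] FGr V G' β' :=
  (Submodule.mapQ ((Vgt V β).comap (V β).subtype) ((Vgt V β').comap (V β').subtype)
    (f.restrict hV) (fun m hm => hgt m hm)).restrict (by
      rintro _ ⟨m, hm, rfl⟩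
      exact ⟨f.restrict hV m, hG m hm, rfl⟩)

theorem Vgt_map_mem {M : Type*} [AddCommGroup M] [Module ℂ M] (V : ℚ → Submodule ℂ M)
    (f : Module.End ℂ M) (c : ℚ) (hV : ∀ χ, ∀ m ∈ V χ, f m ∈ V (χ + c)) {β β' : ℚ}
    (hβ : β' = β + c) : ∀ m ∈ Vgt V β, f m ∈ Vgt V β' := by
  have h : Vgt V β ≤ (Vgt V β').comap f := by
    refine iSup₂_le fun γ hγ m hm => ?_
    exact Submodule.mem_iSup_of_mem (γ + c)
      (Submodule.mem_iSup_of_mem (by rw [hβ]; gcongr) (hV γ m hm))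
  exact h

theorem exists_eq_sum_of_tensor_surjective {K ι A B W W' : Type*} [Field K] [Fintype ι]
    [AddCommGroup A] [Module K A] [AddCommGroup B] [Module K B]
    [AddCommGroup W] [Module K W] [AddCommGroup W'] [Module K W']
    (D : ι → A →ₗ[K] B) (w : ι → W →ₗ[K] W') (δ : A ⊗[K] W →ₗ[K] B ⊗[K] W')
    (hδ : ∀ x ω, δ (x ⊗ₜ ω) = ∑ i, D i x ⊗ₜ w i ω) (hsurj : Function.Surjective δ)
    (φ : W' →ₗ[K] K) (ω : W') (hφ : φ ω = 1) (x : B) :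
    ∃ y : ι → A, x = ∑ i, D i (y i) := by
  obtain ⟨z, hz⟩ := hsurj (x ⊗ₜ ω)
  have key : ((TensorProduct.rid K B).toLinearMap ∘ₗ φ.lTensor B) ∘ₗ δ =
      ∑ i, D i ∘ₗ (TensorProduct.rid K A).toLinearMap ∘ₗ (φ ∘ₗ w i).lTensor A := by
    refine TensorProduct.ext' fun a b => ?_
    simp [hδ]
  refine ⟨fun i => TensorProduct.rid K A ((φ ∘ₗ w i).lTensor A z), ?_⟩
  have h := LinearMap.congr_fun key z
  simpa [hz, hφ] using h

theorem exteriorPower_succ_card_subsingleton (K : Type*) [Field K] (r : ℕ) :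
    Subsingleton (⋀[K]^(r + 1) (Fin r → K)) := by
  rw [← Module.finrank_zero_iff (R := K), exteriorPower.finrank_eq]
  simp

theorem exists_exteriorPower_functional (K : Type*) [Field K] (r : ℕ) :
    ∃ (φ : ⋀[K]^r (Fin r → K) →ₗ[K] K) (ω : ⋀[K]^r (Fin r → K)), φ ω = 1 := by
  refine ⟨exteriorPower.alternatingMapLinearEquiv Matrix.detRowAlternating,
    exteriorPower.ιMulti K r (fun i j => (1 : Matrix (Fin r) (Fin r) K) i j), ?_⟩
  rw [exteriorPower.alternatingMapLinearEquiv_apply_ιMulti]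
  exact Matrix.det_one

theorem mul_prod_ofFn_pow {A : Type*} [Monoid A] {r : ℕ} (d : Fin r → A)
    (hdd : ∀ i j, d i * d j = d j * d i) (α : Fin r → ℕ) (i : Fin r) :
    d i * (List.ofFn fun j => d j ^ α j).prod =
      (List.ofFn fun j => d j ^ (α + Pi.single i 1 : Fin r → ℕ) j).prod := by
  induction r with
  | zero => exact i.elim0
  | succ n ih =>
    simp only [List.ofFn_succ, List.prod_cons]
    cases i using Fin.cases with
    | zero => simp [pow_succ', mul_assoc]
    | succ i =>
      have h := ih (fun j => d j.succ) (fun _ _ => hdd _ _) (fun j => α j.succ) i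
      have hc : Commute (d i.succ) (d 0 ^ α 0) := Commute.pow_right (hdd i.succ 0) (α 0)
      rw [← mul_assoc, hc.eq, mul_assoc, h]
      simp [Pi.single_apply]

theorem prod_ofFn_pow_apply_mem {M : Type*} [AddCommGroup M] [Module ℂ M] {r : ℕ}
    (d : Fin r → Module.End ℂ M) (F : ℤ → Submodule ℂ M)
    (hFd : ∀ (i : Fin r) (p : ℤ), ∀ m ∈ F p, d i m ∈ F (p + 1)) (α : Fin r → ℕ) (p : ℤ)
    (m : M) (hm : m ∈ F p) :
    (List.ofFn fun i => d i ^ α i).prod m ∈ F (p + ((∑ i, α i : ℕ) : ℤ)) := by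
  have hpow : ∀ (i : Fin r) (k : ℕ) (p : ℤ), ∀ m ∈ F p, (d i ^ k) m ∈ F (p + k) := by
    intro i k
    induction k with
    | zero => simp
    | succ k ih =>
      intro p m hm
      rw [pow_succ', Module.End.mul_apply]
      have := hFd i _ _ (ih p m hm)
      rwa [Nat.cast_succ, ← add_assoc]
  induction r with
  | zero => simpa using hm
  | succ n ih =>
    have h := hpow 0 (α 0) _ _ (ih (fun j => d j.succ) (fun _ => hFd _) (fun j => α j.succ)
      (fun _ => hpow _))
    rw [List.ofFn_succ, List.prod_cons, Module.End.mul_apply, Fin.sum_univ_succ]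
    convert h using 2
    push_cast
    ring

theorem exists_sub_sum_mem_Vgt {M : Type*} [AddCommGroup M] [Module ℂ M]
    {V : ℚ → Submodule ℂ M} {G G' : Submodule ℂ M} {β β' : ℚ} {r : ℕ}
    (d : Fin r → Module.End ℂ M) (D : Fin r → FGr V G β →ₗ[ℂ] FGr V G' β')
    (hV : ∀ i, ∀ m ∈ V β, d i m ∈ V β')
    (hD : ∀ i (m : V β) h, ∃ h', D i ⟨Submodule.Quotient.mk m, h⟩ =
      ⟨Submodule.Quotient.mk ⟨d i m, hV i m m.2⟩, h'⟩)
    (hsurj : ∀ x, ∃ y : Fin r → FGr V G β, x = ∑ i, D i (y i))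
    (m : M) (hm : m ∈ G' ⊓ V β') :
    ∃ y : Fin r → M, (∀ i, y i ∈ G ⊓ V β) ∧ m - ∑ i, d i (y i) ∈ Vgt V β' := by
  obtain ⟨y, hy⟩ := hsurj ⟨Submodule.Quotient.mk ⟨m, hm.2⟩, ⟨⟨m, hm.2⟩, hm.1, rfl⟩⟩
  have hy' : ∀ i, ∃ z : V β, (z : M) ∈ G ∧ (Submodule.Quotient.mk z : Gr V β) = y i := by
    intro i
    obtain ⟨z, hz, hzy⟩ := (y i).2
    exact ⟨z, hz, hzy⟩
  choose z hzG hzy using hy'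
  have hDz : ∀ i, (D i (y i) : Gr V β') =
      Submodule.Quotient.mk ⟨d i (z i), hV i (z i) (z i).2⟩ := by
    intro i
    obtain ⟨_, h'⟩ := hD i (z i) (hzy i ▸ (y i).2)
    rw [show y i = ⟨Submodule.Quotient.mk (z i), hzy i ▸ (y i).2⟩ from
      Subtype.ext (hzy i).symm, h']
  refine ⟨fun i => z i, fun i => ⟨hzG i, (z i).2⟩, ?_⟩
  have h := congrArg (Subtype.val : FGr V G' β' → Gr V β') hy
  simp only [AddSubmonoidClass.coe_finsetSum, hDz] at h
  have h2 : (Submodule.Quotient.mk (⟨m, hm.2⟩ : V β') : Gr V β') =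
      Submodule.Quotient.mk (∑ i, ⟨d i (z i), hV i (z i) (z i).2⟩) := by
    rw [h]
    exact (map_sum (Submodule.mkQ _) _ _).symm
  rw [Submodule.Quotient.eq] at h2
  simpa using h2

/-- Let `M` be a complex vector space with a rank-`r` Weyl system
`t_1, …, t_r, ∂_1, …, ∂_r` and an exhaustive, discrete abstract V-filtration `(V^χ)_χ`.
Let `(F_p)_{p ∈ ℤ}` be increasing and exhaustive with `tᵢ(F_p) ⊆ F_p` and
`∂ᵢ(F_p) ⊆ F_{p+1}`.  Assume that for every rational `χ < 0` and every `p` the complex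
with `ℓ`-th term `(F_{p+ℓ} gr^{χ+r-ℓ}) ⊗ Λ^ℓ(ℂ^r)` and differential induced by
`m ⊗ ω ↦ Σᵢ ∂ᵢ(m) ⊗ (eᵢ ∧ ω)` is exact.  Then for every `p`:
`F_p = Σ_{α ∈ ℕ^r} ∂^α (F_{p-|α|} ∩ V^0)`. -/
theorem statement11 (r : ℕ) (hr : 1 ≤ r)
    (M : Type*) [AddCommGroup M] [Module ℂ M]
    (t d : Fin r → Module.End ℂ M)
    (htt : ∀ i j, t i * t j = t j * t i)
    (hdd : ∀ i j, d i * d j = d j * d i)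
    (hdt : ∀ i j, d i * t j - t j * d i = if i = j then 1 else 0)
    (θ : Module.End ℂ M) (hθ : θ = ∑ i, t i * d i)
    (V : ℚ → Submodule ℂ M)
    (hmono : ∀ ⦃χ χ' : ℚ⦄, χ ≤ χ' → V χ' ≤ V χ)
    (hVt : ∀ (i : Fin r) (χ : ℚ), ∀ m ∈ V χ, t i m ∈ V (χ + 1))
    (hVd : ∀ (i : Fin r) (χ : ℚ), ∀ m ∈ V χ, d i m ∈ V (χ - 1))
    (hVnil : ∀ (χ : ℚ), ∀ m ∈ V χ, ∃ k : ℕ, 1 ≤ k ∧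
      (((θ - ((χ : ℂ) - (r : ℂ)) • 1) ^ k) m ∈ Vgt V χ))
    (hVexh : (⨆ χ : ℚ, V χ) = ⊤)
    (hVdisc : ∃ e : ℕ, 0 < e ∧ ∀ k : ℤ, ∀ χ χ' : ℚ,
      χ ∈ Set.Ioc ((k : ℚ) / e) ((k + 1 : ℚ) / e) →
      χ' ∈ Set.Ioc ((k : ℚ) / e) ((k + 1 : ℚ) / e) → V χ = V χ')
    (F : ℤ → Submodule ℂ M)
    (hFmono : Monotone F)
    (hFexh : (⨆ p : ℤ, F p) = ⊤)
    (hFt : ∀ (i : Fin r) (p : ℤ), ∀ m ∈ F p, t i m ∈ F p)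
    (hFd : ∀ (i : Fin r) (p : ℤ), ∀ m ∈ F p, d i m ∈ F (p + 1))
    -- filtered acyclicity of the graded complexes `C^χ` for `χ < 0`
    (hexact : ∀ (χ : ℚ), χ < 0 → ∀ (p : ℤ)
      (D : ∀ (n : ℕ), Fin r → ((FGr V (F (p + n)) (χ + r - n)) →ₗ[ℂ]
        (FGr V (F (p + (n + 1 : ℕ))) (χ + r - (n + 1 : ℕ))))),
      (∀ (n : ℕ) (i : Fin r) (m : M) (hm : m ∈ V (χ + r - n))
          (h1 : (Submodule.Quotient.mk ⟨m, hm⟩ : Gr V (χ + r - n)) ∈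
            FGr V (F (p + n)) (χ + r - n))
          (hm' : d i m ∈ V (χ + r - (n + 1 : ℕ)))
          (h2 : (Submodule.Quotient.mk ⟨d i m, hm'⟩ : Gr V (χ + r - (n + 1 : ℕ))) ∈
            FGr V (F (p + (n + 1 : ℕ))) (χ + r - (n + 1 : ℕ))),
        D n i ⟨Submodule.Quotient.mk ⟨m, hm⟩, h1⟩ =
          ⟨Submodule.Quotient.mk ⟨d i m, hm'⟩, h2⟩) →
      ∀ (δ : ∀ n : ℕ, ((FGr V (F (p + n)) (χ + r - n)) ⊗[ℂ] ⋀[ℂ]^n (Fin r → ℂ)) →ₗ[ℂ]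
          ((FGr V (F (p + (n + 1 : ℕ))) (χ + r - (n + 1 : ℕ))) ⊗[ℂ]
            ⋀[ℂ]^(n+1) (Fin r → ℂ))),
        (∀ (n : ℕ) (x : FGr V (F (p + n)) (χ + r - n)) (ω : ⋀[ℂ]^n (Fin r → ℂ)),
          δ n (x ⊗ₜ[ℂ] ω) = ∑ i, (D n i x) ⊗ₜ[ℂ] (wedgeMap ℂ (Pi.single i 1) n ω)) →
        (LinearMap.ker (δ 0) = ⊥ ∧
          ∀ n : ℕ, LinearMap.ker (δ (n+1)) = LinearMap.range (δ n))) :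
    ∀ p : ℤ, F p = ⨆ α : Fin r → ℕ,
      Submodule.map ((List.ofFn fun i => (d i) ^ (α i)).prod)
        (F (p - ((∑ i, α i : ℕ) : ℤ)) ⊓ V 0) := by
  have step : ∀ χ : ℚ, χ < 0 → ∀ p : ℤ, ∀ m ∈ F p ⊓ V χ,
      ∃ y : Fin r → M, (∀ i, y i ∈ F (p - 1) ⊓ V (χ + 1)) ∧
        m - ∑ i, d i (y i) ∈ Vgt V χ := by
    intro χ hχ p m hm
    have hV : ∀ (n : ℕ) (i : Fin r), ∀ m ∈ V (χ + r - n),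
        d i m ∈ V (χ + r - (n + 1 : ℕ)) := by
      intro n i m hm
      convert hVd i _ m hm using 2
      push_cast
      ring
    have hgt : ∀ (n : ℕ) (i : Fin r), ∀ m ∈ Vgt V (χ + r - n),
        d i m ∈ Vgt V (χ + r - (n + 1 : ℕ)) := fun n i =>
      Vgt_map_mem V (d i) (-1) (fun β m hm => sub_eq_add_neg β 1 ▸ hVd i β m hm) (by push_cast; ring)
    have hG : ∀ (n : ℕ) (i : Fin r), ∀ m ∈ F (p - r + n),
        d i m ∈ F (p - r + (n + 1 : ℕ)) := by
      intro n i m hm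
      convert hFd i _ m hm using 2
      push_cast
      ring
    let D := fun (n : ℕ) (i : Fin r) => FGrMap V (d i) (hV n i) (hgt n i) (hG n i)
    let δ := fun n : ℕ => ∑ i, TensorProduct.map (D n i)
      (wedgeMap ℂ (Pi.single i 1 : Fin r → ℂ) n)
    have hδ : ∀ n x ω, δ n (x ⊗ₜ[ℂ] ω) =
        ∑ i, (D n i x) ⊗ₜ[ℂ] (wedgeMap ℂ (Pi.single i 1) n ω) := by
      intro n x ω
      simp [δ]
    have hex := (hexact χ hχ (p - r) D (fun _ _ _ _ _ _ _ => rfl) δ hδ).2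
    obtain ⟨s, rfl⟩ : ∃ s, r = s + 1 := ⟨r - 1, by omega⟩
    have hsurj : Function.Surjective (δ s) := by
      have := exteriorPower_succ_card_subsingleton ℂ (s + 1)
      rw [← LinearMap.range_eq_top, ← hex s, LinearMap.ker_eq_top]
      refine TensorProduct.ext' fun x ω => ?_
      rw [hδ]
      refine Finset.sum_eq_zero fun i _ => ?_
      rw [Subsingleton.elim (wedgeMap ℂ _ _ ω) 0, TensorProduct.tmul_zero]
    obtain ⟨φ, ω, hφ⟩ := exists_exteriorPower_functional ℂ (s + 1)
    have e1 : χ + ((s + 1 : ℕ) : ℚ) - ((s + 1 : ℕ) : ℚ) = χ := by ring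
    have e2 : χ + ((s + 1 : ℕ) : ℚ) - (s : ℚ) = χ + 1 := by push_cast; ring
    have e3 : p - ((s + 1 : ℕ) : ℤ) + ((s + 1 : ℕ) : ℤ) = p := by ring
    have e4 : p - ((s + 1 : ℕ) : ℤ) + (s : ℤ) = p - 1 := by push_cast; ring
    have h := exists_sub_sum_mem_Vgt d (D s) (hV s) (fun _ _ _ => ⟨_, rfl⟩)
      (exists_eq_sum_of_tensor_surjective (D s) _ (δ s) (hδ s) hsurj φ ω hφ) m
      (by rwa [e1, e3])
    rwa [e1, e2, e4] at h
  intro p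
  apply le_antisymm
  · set R : ℤ → Submodule ℂ M := fun p => ⨆ α : Fin r → ℕ,
      Submodule.map ((List.ofFn fun i => (d i) ^ (α i)).prod)
        (F (p - ((∑ i, α i : ℕ) : ℤ)) ⊓ V 0)
    have hRd : ∀ i p, R (p - 1) ≤ (R p).comap (d i) := by
      refine fun i p => iSup_le fun α => ?_
      rintro _ ⟨m, hm, rfl⟩
      refine Submodule.mem_iSup_of_mem (α + Pi.single i 1) ⟨m, ?_, ?_⟩
      · convert hm using 4
        simp [Finset.sum_add_distrib]
        ring
      · rw [← mul_prod_ofFn_pow d hdd, Module.End.mul_apply]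
    obtain ⟨e, he, hdisc⟩ := hVdisc
    have he' : (0 : ℚ) < e := by exact_mod_cast he
    have main : ∀ N : ℕ, ∀ p, F p ⊓ V (-(N : ℚ) / e) ≤ R p := by
      intro N
      induction N with
      | zero =>
        intro p m hm
        exact Submodule.mem_iSup_of_mem 0 ⟨m, by simpa using hm, by simp⟩
      | succ N ih =>
        intro p m hm
        have hlt : -((N + 1 : ℕ) : ℚ) / e < -(N : ℚ) / e := by
          gcongr
          simp
        obtain ⟨y, hy, hmy⟩ := step (-((N + 1 : ℕ) : ℚ) / e)
          (div_neg_of_neg_of_pos (neg_neg_of_pos (by positivity)) he') p m hm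
        have hyR : ∀ i, y i ∈ R (p - 1) := fun i => by
          refine ih (p - 1) ⟨(hy i).1, hmono ?_ (hy i).2⟩
          rw [div_add_one he'.ne']
          gcongr
          push_cast
          have : (1 : ℚ) ≤ e := by exact_mod_cast he
          linarith
        have hgt : Vgt V (-((N + 1 : ℕ) : ℚ) / e) ≤ V (-(N : ℚ) / e) := by
          refine iSup₂_le fun β hβ => ?_
          rcases le_total (-(N : ℚ) / e) β with h | h
          · exact hmono h
          · refine (hdisc (-((N + 1 : ℕ) : ℤ)) β (-(N : ℚ) / e) ?_ ?_).le
            · refine ⟨by simpa using hβ, h.trans_eq ?_⟩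
              push_cast
              ring
            · refine ⟨by simpa using hlt, le_of_eq ?_⟩
              push_cast
              ring
        have hF : m - ∑ i, d i (y i) ∈ F p := by
          refine Submodule.sub_mem _ hm.1 (Submodule.sum_mem _ fun i _ => ?_)
          simpa using hFd i _ _ (hy i).1
        rw [← sub_add_cancel m (∑ i, d i (y i))]
        exact Submodule.add_mem _ (ih p ⟨hF, hgt hmy⟩)
          (Submodule.sum_mem _ fun i _ => hRd i p (hyR i))
    intro m hm
    have hmV : m ∈ ⨆ χ : ℚ, V χ := hVexh ▸ Submodule.mem_top
    rw [Submodule.mem_iSup_of_directed V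
      (fun a b => ⟨min a b, hmono (min_le_left _ _), hmono (min_le_right _ _)⟩)] at hmV
    obtain ⟨χ, hχ⟩ := hmV
    obtain ⟨N, hN⟩ := exists_nat_ge (-χ * e)
    refine main N p ⟨hm, hmono ?_ hχ⟩
    rw [div_le_iff₀ he']
    linarith
  · refine iSup_le fun α => ?_
    rintro _ ⟨m, hm, rfl⟩
    simpa using prod_ofFn_pow_apply_mem d F hFd α _ m hm.1
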